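/- For a finite MDP with discount factor γ ∈ [0,1), let v* be the unique fixed point of the Bellman optimality operator and, for each policy π, let v_π be the unique fixed point of the Bellman expectation operator T_π. Then v* is the optimal state-value function: v_π(s) ≤ v*(s) for every policy π and every state s ∈ S. -/

import Mathlib

theorem PMF.sum_toReal_eq_one {α : Type*} [Fintype α] (p : PMF α) :
    ∑ a, (p a).toReal = 1 := by
  rw [← ENNReal.toReal_sum fun a _ => p.apply_ne_top a, ← tsum_fintype (L := .unconditional α),
    p.tsum_coe, ENNReal.toReal_one]

theorem PMF.sum_toReal_mul_le {α : Type*} [Fintype α] (p : PMF α) {f : α → ℝ} {c : ℝ}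
    (h : ∀ a, f a ≤ c) : ∑ a, (p a).toReal * f a ≤ c :=
  calc ∑ a, (p a).toReal * f a ≤ ∑ a, (p a).toReal * c :=
        Finset.sum_le_sum fun a _ => mul_le_mul_of_nonneg_left (h a) ENNReal.toReal_nonneg
    _ = c := by rw [← Finset.sum_mul, p.sum_toReal_eq_one, one_mul]

/-- Let `v*` be the unique fixed point of the Bellman optimality operator and,
for a policy `π`, let `v_π` be the unique fixed point of the Bellman expectation operator
`T_π`. Then `v*` dominates the state-value function of every policy: `v_π s ≤ v* s`. -/
theorem optimal_value_dominates_policy_value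
    {S A : Type*} [Fintype S] [Fintype A] [Nonempty S] [Nonempty A]
    (P : S → A → PMF S) (R : S → A → ℝ)
    (γ : ℝ) (hγ0 : 0 ≤ γ) (hγ1 : γ < 1)
    (vstar : S → ℝ)
    (hvstar : ∀ s, vstar s =
      Finset.univ.sup' Finset.univ_nonempty
        (fun a : A => R s a + γ * ∑ s', ((P s a) s').toReal * vstar s'))
    (π : S → PMF A) (vπ : S → ℝ)
    (hvπ : ∀ s, vπ s =
      ∑ a, ((π s) a).toReal * (R s a + γ * ∑ s', ((P s a) s').toReal * vπ s')) :
    ∀ s, vπ s ≤ vstar s := by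
  obtain ⟨s₀, hs₀⟩ := Finite.exists_max fun s => vπ s - vstar s
  have hback : vπ s₀ ≤ vstar s₀ + γ * (vπ s₀ - vstar s₀) := by
    conv_lhs => rw [hvπ s₀]
    refine (π s₀).sum_toReal_mul_le fun a => ?_
    have hopt : R s₀ a + γ * ∑ s', ((P s₀ a) s').toReal * vstar s' ≤ vstar s₀ := by
      conv_rhs => rw [hvstar s₀]
      exact Finset.le_sup' (fun a : A => R s₀ a + γ * ∑ s', ((P s₀ a) s').toReal * vstar s')
        (Finset.mem_univ a)
    have hdiff := mul_le_mul_of_nonneg_left ((P s₀ a).sum_toReal_mul_le hs₀) hγ0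
    simp only [mul_sub, Finset.sum_sub_distrib] at hdiff ⊢
    linarith
  have hmax : vπ s₀ - vstar s₀ ≤ 0 := by
    by_contra! hpos
    nlinarith [mul_pos (sub_pos.mpr hγ1) hpos]
  intro s
  linarith [hs₀ s]
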